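/- Let A ⊆ G = Z_{p^n} × Z_q × Z_r and let i be an integer with 0 ≤ i ≤ n. Then χ_{(p^i,0,1)}(A) = 0 if and only if for all k ∈ {0,…,r−1} one has ∑_{j=0}^{q−1} (χ_{p^i,p^n}(A_{jk}) − χ_{p^i,p^n}(A_{j0})) = 0. -/

import Mathlib

open Finset

/-- `chiX M m X = ∑_{x ∈ X} e^{2πi·m·x/M}`. -/
noncomputable def chiX (M : ℕ) (m : ℕ) (X : Finset (ZMod M)) : ℂ :=
  ∑ x ∈ X, Complex.exp (2 * Real.pi * Complex.I * m * x.val / M)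

/-- The fiber `A_{jk} = {x ∈ Z_{p^n} : (x, j, k) ∈ A}`. -/
def fiber (p q r n : ℕ) (A : Finset (ZMod (p ^ n) × ZMod q × ZMod r)) (j k : ℕ) :
    Finset (ZMod (p ^ n)) :=
  (A.filter fun g => g.2.1 = (j : ZMod q) ∧ g.2.2 = (k : ZMod r)).image Prod.fst

/-- `chiG p q r n m s t A = ∑_{(x,j,k) ∈ A} e^{2πi(m·x/p^n + s·j/q + t·k/r)}`. -/
noncomputable def chiG (p q r n : ℕ) (m s t : ℕ)
    (A : Finset (ZMod (p ^ n) × ZMod q × ZMod r)) : ℂ :=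
  ∑ g ∈ A, Complex.exp (2 * Real.pi * Complex.I *
    (m * g.1.val / (p ^ n : ℕ) + s * g.2.1.val / q + t * g.2.2.val / r))

open Polynomial IntermediateField in
/-- Cyclotomic polynomials stay irreducible over cyclotomic fields of coprime conductor; here in the
form of a lower bound on the degree of a primitive root of unity. -/
theorem totient_le_natDegree_minpoly_adjoin {m n : ℕ} [NeZero m] [NeZero n] (hmn : m.Coprime n)
    {ζ ω : ℂ} (hζ : IsPrimitiveRoot ζ m) (hω : IsPrimitiveRoot ω n) :
    n.totient ≤ (minpoly ℚ⟮ζ⟯ ω).natDegree := by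
  have hintζ : IsIntegral ℚ ζ := (hζ.isIntegral (NeZero.pos m)).tower_top
  have hfd : FiniteDimensional ℚ ℚ⟮ζ⟯ := adjoin.finiteDimensional hintζ
  have hK : Module.finrank ℚ ℚ⟮ζ⟯ = m.totient := by
    rw [adjoin.finrank hintζ, ← cyclotomic_eq_minpoly_rat hζ (NeZero.pos m), natDegree_cyclotomic]
  have hint : IsIntegral ℚ⟮ζ⟯ ω := (hω.isIntegral (NeZero.pos n)).tower_top
  have hfd' : FiniteDimensional ℚ⟮ζ⟯ ℚ⟮ζ⟯⟮ω⟯ := adjoin.finiteDimensional hint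
  have : FiniteDimensional ℚ ℚ⟮ζ⟯⟮ω⟯ := FiniteDimensional.trans ℚ ℚ⟮ζ⟯ _
  have hx : IsPrimitiveRoot (algebraMap ℚ⟮ζ⟯ ℚ⟮ζ⟯⟮ω⟯ (AdjoinSimple.gen ℚ ζ)) m :=
    IsPrimitiveRoot.of_map_of_injective (f := algebraMap ℚ⟮ζ⟯⟮ω⟯ ℂ) hζ
      (algebraMap ℚ⟮ζ⟯⟮ω⟯ ℂ).injective
  have hy : IsPrimitiveRoot (AdjoinSimple.gen ℚ⟮ζ⟯ ω) n :=
    IsPrimitiveRoot.of_map_of_injective (f := algebraMap ℚ⟮ζ⟯⟮ω⟯ ℂ) hω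
      (algebraMap ℚ⟮ζ⟯⟮ω⟯ ℂ).injective
  have h := hx.lcm_totient_le_finrank hy
    (cyclotomic.irreducible_rat (Nat.pos_of_ne_zero (Nat.lcm_ne_zero (NeZero.ne m) (NeZero.ne n))))
  rw [hmn.lcm_eq_mul, Nat.totient_mul hmn, ← Module.finrank_mul_finrank ℚ ℚ⟮ζ⟯ ℚ⟮ζ⟯⟮ω⟯, hK,
    adjoin.finrank hint] at h
  exact Nat.le_of_mul_le_mul_left h (Nat.totient_pos.2 (NeZero.pos m))

open Polynomial IntermediateField in
/-- A linear relation among the powers of a root of unity of prime order `r`, with coefficients in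
a cyclotomic field of conductor prime to `r`, is a multiple of `1 + ω + ⋯ + ω ^ (r - 1) = 0`. -/
theorem sum_mul_pow_eq_zero_iff {m r : ℕ} [NeZero m] (hr : r.Prime) (hmr : m.Coprime r)
    {ζ ω : ℂ} (hζ : IsPrimitiveRoot ζ m) (hω : IsPrimitiveRoot ω r) (c : ℕ → ℂ)
    (hc : ∀ k, c k ∈ ℚ⟮ζ⟯) :
    ∑ k ∈ range r, c k * ω ^ k = 0 ↔ ∀ k < r, c k = c 0 := by
  have hgeom : ∑ k ∈ range r, ω ^ k = 0 := hω.geom_sum_eq_zero hr.one_lt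
  refine ⟨fun h => ?_, fun h => ?_⟩
  · have : NeZero r := ⟨hr.ne_zero⟩
    obtain ⟨s, rfl⟩ : ∃ s, r = s + 1 := ⟨r - 1, (Nat.succ_pred_prime hr).symm⟩
    set f : ℚ⟮ζ⟯[X] := ∑ k ∈ range s, C (⟨c k, hc k⟩ - ⟨c s, hc s⟩) * X ^ k with hf
    have hroot : aeval ω f = 0 := by
      have haeval : aeval ω f = ∑ k ∈ range (s + 1), (c k - c s) * ω ^ k := by
        rw [sum_range_succ, sub_self, zero_mul, add_zero, hf, map_sum]
        refine sum_congr rfl fun k _ => ?_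
        rw [map_mul, aeval_C, map_pow, aeval_X, map_sub]
        rfl
      rw [haeval]
      simp only [sub_mul]
      rw [sum_sub_distrib, h, ← mul_sum, hgeom, mul_zero, sub_zero]
    have hdeg : f.degree < s := by
      refine (degree_sum_le _ _).trans_lt ((Finset.sup_lt_iff (WithBot.bot_lt_coe s)).2 ?_)
      intro k hk
      exact (degree_C_mul_X_pow_le k _).trans_lt (Nat.cast_lt.2 (mem_range.1 hk))
    have hf0 : f = 0 := by
      by_contra hne
      have h1 := natDegree_le_natDegree (minpoly.degree_le_of_ne_zero _ ω hne hroot)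
      have h2 := totient_le_natDegree_minpoly_adjoin hmr hζ hω
      rw [Nat.totient_prime hr, Nat.add_sub_cancel] at h2
      exact absurd ((natDegree_lt_iff_degree_lt hne).2 hdeg) (by omega)
    have hcs : ∀ k < s + 1, c k = c s := by
      intro k hk
      rcases Nat.lt_succ_iff_lt_or_eq.1 hk with hk | rfl
      · have hcoeff := congrArg (fun g => coeff g k) hf0
        simp only [hf, finsetSum_coeff, coeff_C_mul_X_pow, coeff_zero] at hcoeff
        rw [sum_ite_eq, if_pos (mem_range.2 hk), sub_eq_zero] at hcoeff
        exact congrArg Subtype.val hcoeff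
      · rfl
    intro k hk
    rw [hcs k hk, hcs 0 s.succ_pos]
  · rw [sum_congr rfl fun k hk => by rw [h k (mem_range.1 hk)], ← mul_sum, hgeom, mul_zero]

theorem chiX_fiber (p q r n m : ℕ) (A : Finset (ZMod (p ^ n) × ZMod q × ZMod r)) (j k : ℕ) :
    chiX (p ^ n) m (fiber p q r n A j k) =
      ∑ g ∈ A with g.2.1 = (j : ZMod q) ∧ g.2.2 = (k : ZMod r),
        Complex.exp (2 * Real.pi * Complex.I * m * g.1.val / (p ^ n : ℕ)) := by
  rw [chiX, fiber, sum_image]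
  rintro ⟨x, y, z⟩ hg ⟨x', y', z'⟩ hg' h
  simp only [coe_filter, Set.mem_ofPred_eq] at hg hg'
  obtain ⟨-, rfl, rfl⟩ := hg
  obtain ⟨-, rfl, rfl⟩ := hg'
  simpa using h

theorem chiX_mem_adjoin (M m : ℕ) (X : Finset (ZMod M)) :
    chiX M m X ∈ IntermediateField.adjoin ℚ {Complex.exp (2 * Real.pi * Complex.I / M)} := by
  refine sum_mem fun x _ => ?_
  have h : Complex.exp (2 * Real.pi * Complex.I * m * x.val / M) =
      Complex.exp (2 * Real.pi * Complex.I / M) ^ (m * x.val) := by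
    rw [← Complex.exp_nat_mul]
    push_cast
    ring_nf
  rw [h]
  exact pow_mem (IntermediateField.mem_adjoin_simple_self ℚ _) _

theorem chiG_zero_one_eq_sum (p q r n m : ℕ) [NeZero q] [NeZero r]
    (A : Finset (ZMod (p ^ n) × ZMod q × ZMod r)) :
    chiG p q r n m 0 1 A =
      ∑ k ∈ range r, (∑ j ∈ range q, chiX (p ^ n) m (fiber p q r n A j k)) *
        Complex.exp (2 * Real.pi * Complex.I / r) ^ k := by
  have hcast {N : ℕ} [NeZero N] (z : ZMod N) {k : ℕ} (hk : k ∈ range N) :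
      z.val = k ↔ z = (k : ZMod N) := by
    rw [← (ZMod.val_injective N).eq_iff, ZMod.val_cast_of_lt (mem_range.1 hk)]
  rw [chiG, ← sum_fiberwise_of_maps_to (t := range r) (g := fun g => g.2.2.val)
    fun g _ => mem_range.2 (ZMod.val_lt _)]
  refine sum_congr rfl fun k hk => ?_
  rw [← sum_fiberwise_of_maps_to (t := range q) (g := fun g => g.2.1.val)
    fun g _ => mem_range.2 (ZMod.val_lt _), sum_mul]
  refine sum_congr rfl fun j hj => ?_
  rw [chiX_fiber, sum_mul, filter_filter]
  refine sum_congr (filter_congr fun g _ => by rw [hcast _ hk, hcast _ hj, and_comm])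
    fun g hg => ?_
  rw [(hcast _ hk).2 (mem_filter.1 hg).2.2, ← Complex.exp_nat_mul, ← Complex.exp_add]
  push_cast
  ring_nf

theorem zero_iff_fiber_relation_0_1 (p q r n : ℕ) (hp : p.Prime) (hq : q.Prime)
    (hr : r.Prime) (hpq : p ≠ q) (hpr : p ≠ r) (hqr : q ≠ r) (hn : 0 < n)
    (A : Finset (ZMod (p ^ n) × ZMod q × ZMod r)) (i : ℕ) (hi : i ≤ n) :
    chiG p q r n (p ^ i) 0 1 A = 0 ↔
      ∀ k < r, ∑ j ∈ Finset.range q,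
        (chiX (p ^ n) (p ^ i) (fiber p q r n A j k)
          - chiX (p ^ n) (p ^ i) (fiber p q r n A j 0)) = 0 := by
  have : NeZero (p ^ n) := ⟨pow_ne_zero n hp.ne_zero⟩
  have : NeZero q := ⟨hq.ne_zero⟩
  have : NeZero r := ⟨hr.ne_zero⟩
  rw [chiG_zero_one_eq_sum, sum_mul_pow_eq_zero_iff hr
    (Nat.Coprime.pow_left n ((Nat.coprime_primes hp hr).2 hpr))
    (Complex.isPrimitiveRoot_exp _ (NeZero.ne (p ^ n))) (Complex.isPrimitiveRoot_exp r hr.ne_zero)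
    _ fun k => sum_mem fun j _ => chiX_mem_adjoin _ _ _]
  simp only [sum_sub_distrib, sub_eq_zero]
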